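/- Action of the operators A_i on a family satisfying the Jack eigenvalue equation and Pieri rule: suppose given a family (J_λ) of elements of 𝒫 indexed by all partitions, and scalars c_{λ↗μ} ∈ K for every pair of partitions with λ ↗ μ, such that for every partition λ: (i) D_α J_λ = ( Σ_{□ ∈ λ} c_α(□) )·J_λ, the sum being over all boxes of the Young diagram of λ, and (ii) p_1·J_λ = Σ_{μ : λ↗μ} c_{λ↗μ}·J_μ (a finite sum over all partitions μ covering λ). Then for every integer i ≥ 1 and every partition λ: A_i J_λ = Σ_{μ : λ↗μ} c_α(μ∖λ)^{i−1}·(c_{λ↗μ}/α)·J_μ. (For the Jack symmetric functions J_λ^{(α)}, hypotheses (i) and (ii) hold by results of Stanley, so this computes the action of A_i on Jack polynomials expressed in the power-sum variables.) -/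

import Mathlib

open MvPolynomial

noncomputable section

/-- The base field `K = ℚ(b)`: rational functions in an indeterminate `b` over `ℚ`. -/
abbrev K : Type := RatFunc ℚ

/-- The indeterminate `b ∈ K`. -/
def bb : K := RatFunc.X

/-- `α = 1 + b`. -/
def alpha : K := 1 + bb

/-- Variables: `p i` (used for `i ≥ 1`) and `y i` (used for `i ≥ 0`). -/
inductive Var : Type
  | p : ℕ → Var
  | y : ℕ → Var
  deriving DecidableEq

/-- The ambient polynomial ring `R = K[p₁, p₂, …, y₀, y₁, …]`. -/
abbrev R : Type := MvPolynomial Var K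

/-- The variable `p_i`. -/
def P (i : ℕ) : R := X (Var.p i)

/-- The variable `y_i`. -/
def Y (i : ℕ) : R := X (Var.y i)

/-- Partial derivative `∂/∂p_i`. -/
def dP (i : ℕ) (f : R) : R := pderiv (Var.p i) f

/-- Partial derivative `∂/∂y_i`. -/
def dY (i : ℕ) (f : R) : R := pderiv (Var.y i) f

/-- `𝒫`: the subalgebra of polynomials in the `p`-variables only. -/
def Psub : Subalgebra K R := MvPolynomial.supported K (Set.range Var.p)

/-- `𝒫_Y`: the `K`-linear span of the monomials `p_λ` and `y_i·p_λ`. -/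
def PY : Submodule K R :=
  Submodule.span K ((Psub : Set R) ∪ {g : R | ∃ i : ℕ, ∃ f ∈ (Psub : Set R), g = Y i * f})

/-- The Laplace–Beltrami operator
`D_α = (1/2)(α Σ_{i,j≥1} i j p_{i+j} ∂²/∂p_i∂p_j + Σ_{i,j≥1} (i+j) p_i p_j ∂/∂p_{i+j}
        + b Σ_{i≥1} i(i−1) p_i ∂/∂p_i)`. -/
def Dalpha (f : R) : R :=
  (2 : K)⁻¹ •
    (alpha • (∑ᶠ (i : ℕ) (j : ℕ), (((i + 1) * (j + 1) : ℕ) : K) •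
        (P (i + 1 + (j + 1)) * dP (i + 1) (dP (j + 1) f)))
      + (∑ᶠ (i : ℕ) (j : ℕ), (((i + 1) + (j + 1) : ℕ) : K) •
        (P (i + 1) * P (j + 1) * dP (i + 1 + (j + 1)) f))
      + bb • (∑ᶠ (i : ℕ), (((i + 1) * i : ℕ) : K) • (P (i + 1) * dP (i + 1) f)))

/-- `Λ_Y = α Σ_{i,j≥1} i y_{i+j−1} ∂²/∂p_i∂y_{j−1} + Σ_{i,j≥1} y_{i−1} p_j ∂/∂y_{i+j−1}
      + b Σ_{i≥1} i y_i ∂/∂y_i`. -/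
def LamY (f : R) : R :=
  alpha • (∑ᶠ (i : ℕ) (j : ℕ), ((i + 1 : ℕ) : K) • (Y (i + j + 1) * dP (i + 1) (dY j f)))
    + (∑ᶠ (i : ℕ) (j : ℕ), Y i * P (j + 1) * dY (i + j + 1) f)
    + bb • (∑ᶠ (i : ℕ), ((i + 1 : ℕ) : K) • (Y (i + 1) * dY (i + 1) f))

/-- `Y_+ = Σ_{i≥0} y_{i+1} ∂/∂y_i`. -/
def Yplus (f : R) : R := ∑ᶠ (i : ℕ), Y (i + 1) * dY i f

/-- `Θ_Y = Σ_{i≥1} p_i ∂/∂y_i`. -/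
def ThetaY (f : R) : R := ∑ᶠ (i : ℕ), P (i + 1) * dY (i + 1) f

/-- `A j` is the operator `A_{j+1}` of the paper:
`A_{j+1} f = (1/(1+b))·Θ_Y(Y_+(Λ_Y^j(y₀·f)))`. -/
def A (j : ℕ) (f : R) : R := (1 + bb)⁻¹ • ThetaY (Yplus (LamY^[j] (Y 0 * f)))

/-- The `α`-content of a (0-indexed) box `c = (row, column)`:
`c_α = α·(column) − (row)` (i.e. `α(x−1) − (r−1)` for the 1-indexed box `(x, r)`). -/
def contentAlpha (c : ℕ × ℕ) : K := alpha * (c.2 : K) - (c.1 : K)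

/-- `lam ↗ mu`: the Young diagram `mu` is obtained from `lam` by adding a single box. -/
def Covers (lam mu : YoungDiagram) : Prop := lam ≤ mu ∧ mu.card = lam.card + 1

open Finset.HasAntidiagonal (antidiagonal)

theorem hasFiniteSupport_pderiv (f : R) :
    (fun i : ℕ => pderiv (Var.p i) f).HasFiniteSupport := by
  have hinj : Function.Injective Var.p := fun a b h => Var.p.inj h
  refine (f.vars.finite_toSet.preimage hinj.injOn).subset fun i hi => ?_
  by_contra h
  exact hi (pderiv_eq_zero_of_notMem_vars h)

theorem hasFiniteSupport_of_pderiv (f : R) {F : ℕ → R}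
    (h : ∀ i, pderiv (Var.p i) f = 0 → F i = 0) : F.HasFiniteSupport :=
  (hasFiniteSupport_pderiv f).subset fun i hi hf => hi (h i hf)

/-- A sum of derivations that is finite on each generator is a derivation. -/
theorem finsum_derivation_apply {ι : Type*} (D : ι → Derivation K R R)
    (h : ∀ v, (fun i => D i (X v)).HasFiniteSupport) (f : R) :
    (fun i => D i f).HasFiniteSupport ∧
      ∑ᶠ i, D i f = mkDerivation K (fun v => ∑ᶠ i, D i (X v)) f := by
  induction f using MvPolynomial.induction_on with
  | C a => simp [Function.HasFiniteSupport]
  | add f g hf hg =>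
    simp only [map_add]
    refine ⟨(hf.1.union hg.1).subset (Function.support_add _ _), ?_⟩
    rw [finsum_add_distrib hf.1 hg.1, hf.2, hg.2]
  | mul_X f v hf =>
    simp only [Derivation.leibniz, smul_eq_mul]
    have h1 : (fun i => f * D i (X v)).HasFiniteSupport :=
      (h v).subset (Function.support_mul_subset_right _ _)
    have h2 : (fun i => X v * D i f).HasFiniteSupport :=
      hf.1.subset (Function.support_mul_subset_right _ _)
    refine ⟨(h1.union h2).subset (Function.support_add _ _), ?_⟩
    rw [finsum_add_distrib h1 h2, ← mul_finsum, ← mul_finsum, hf.2, mkDerivation_X]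

theorem finsum_succ_eq {M : Type*} [AddCommMonoid M] (f : ℕ → M) (h : f 0 = 0) :
    ∑ᶠ i, f (i + 1) = ∑ᶠ i, f i := by
  rw [← finsum_mem_range Nat.succ_injective (f := f), ← finsum_mem_univ f]
  refine finsum_mem_inter_support_eq' _ _ _ fun i hi => ?_
  cases i with
  | zero => exact absurd h hi
  | succ i => simp

theorem finsum_mul_pderiv (g : ℕ → Var) (hg : Function.Injective g) (a : ℕ → R) (w : Var → R)
    (hw : ∀ j, w (g j) = a j) (hw' : ∀ v, v ∉ Set.range g → w v = 0) (f : R) :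
    ∑ᶠ j, a j * pderiv (g j) f = mkDerivation K w f := by
  have key : ∀ v j, v ≠ g j → (a j • pderiv (R := K) (g j)) (X v) = 0 := fun v j h => by
    simp [pderiv_X_of_ne h]
  have h := finsum_derivation_apply (fun j => a j • pderiv (R := K) (g j)) (fun v => by
    by_cases hv : v ∈ Set.range g
    · obtain ⟨n, rfl⟩ := hv
      refine (Set.finite_singleton n).subset fun j hj => ?_
      by_contra hne
      exact hj (key _ _ fun h => hne (hg h.symm))
    · refine Set.finite_empty.subset fun j hj => hj (key _ _ fun h => hv ⟨j, h.symm⟩)) f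
  refine h.2.trans ?_
  congr 2
  ext1 v
  by_cases hv : v ∈ Set.range g
  · obtain ⟨n, rfl⟩ := hv
    rw [finsum_eq_single _ n fun j hj => key _ _ fun h => hj (hg h.symm), hw]
    simp
  · rw [hw' v hv, finsum_congr fun j => key _ _ fun h => hv ⟨j, h.symm⟩, finsum_zero]

theorem finsum_mul_pderiv_add (g : ℕ → Var) (hg : Function.Injective g) (a : ℕ → ℕ → R)
    (w : Var → R) (hw : ∀ n, w (g n) = ∑ x ∈ antidiagonal n, a x.1 x.2)
    (hw' : ∀ v, v ∉ Set.range g → w v = 0) (f : R) :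
    ∑ᶠ (i : ℕ) (j : ℕ), a i j * pderiv (g (i + j)) f = mkDerivation K w f := by
  have key : ∀ v (x : ℕ × ℕ), v ≠ g (x.1 + x.2) →
      (a x.1 x.2 • pderiv (R := K) (g (x.1 + x.2))) (X v) = 0 := fun v j h => by
    simp [pderiv_X_of_ne h]
  have hsub : ∀ n, (Function.support fun x : ℕ × ℕ =>
      (a x.1 x.2 • pderiv (R := K) (g (x.1 + x.2))) (X (g n))) ⊆ antidiagonal n := by
    intro n x hx
    by_contra hne
    exact hx (key _ _ fun h => hne (by simp [hg h]))
  have h := finsum_derivation_apply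
    (fun x : ℕ × ℕ => a x.1 x.2 • pderiv (R := K) (g (x.1 + x.2))) (fun v => by
      by_cases hv : v ∈ Set.range g
      · obtain ⟨n, rfl⟩ := hv
        exact (antidiagonal n).finite_toSet.subset (hsub n)
      · refine Set.finite_empty.subset fun x hx => hx (key _ _ fun h => hv ⟨_, h.symm⟩)) f
  refine (finsum_curry _ h.1).symm.trans (h.2.trans ?_)
  congr 2
  ext1 v
  by_cases hv : v ∈ Set.range g
  · obtain ⟨n, rfl⟩ := hv
    rw [finsum_eq_sum_of_support_subset _ (hsub n), hw]
    refine Finset.sum_congr rfl fun x hx => ?_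
    simp [Finset.HasAntidiagonal.mem_antidiagonal.1 hx]
  · rw [hw' v hv, finsum_congr fun x => key _ x fun h => hv ⟨_, h.symm⟩, finsum_zero]

theorem pderiv_comm (u v : Var) (f : R) : pderiv u (pderiv v f) = pderiv v (pderiv u f) := by
  have h : ⁅pderiv (R := K) u, pderiv (R := K) v⁆ = 0 := by
    refine derivation_ext fun w => ?_
    rw [Derivation.commutator_apply, pderiv_X, pderiv_X, Pi.single_apply, Pi.single_apply]
    split_ifs <;> simp
  rw [← sub_eq_zero, ← Derivation.commutator_apply, h, Derivation.zero_apply]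

/-- The operator `f ↦ Σ_i i·Δ_i(∂f/∂p_i)`. -/
def secondOrder (Δ : ℕ → Derivation K R R) : R →ₗ[K] R where
  toFun f := ∑ᶠ i : ℕ, (i : K) • Δ i (pderiv (Var.p i) f)
  map_add' f g := by
    rw [← finsum_add_distrib]
    · simp only [map_add, smul_add]
    all_goals
      exact hasFiniteSupport_of_pderiv _ fun i h => by rw [h, map_zero, smul_zero]
  map_smul' a f := by
    simp only [Derivation.map_smul, RingHom.id_apply, smul_finsum, smul_comm a]

theorem secondOrder_apply (Δ : ℕ → Derivation K R R) (f : R) :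
    secondOrder Δ f = ∑ᶠ i : ℕ, (i : K) • Δ i (pderiv (Var.p i) f) := rfl

theorem secondOrder_one (Δ : ℕ → Derivation K R R) : secondOrder Δ 1 = 0 := by
  simp [secondOrder_apply]

theorem secondOrder_Y (Δ : ℕ → Derivation K R R) (m : ℕ) : secondOrder Δ (Y m) = 0 := by
  simp [secondOrder_apply, Y, pderiv_X]

theorem secondOrder_Y_mul (Δ : ℕ → Derivation K R R) (m : ℕ) (hΔ : ∀ i, Δ i (Y m) = 0) (f : R) :
    secondOrder Δ (Y m * f) = Y m * secondOrder Δ f := by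
  have h0 : ∀ i, pderiv (Var.p i) (Y m) = 0 := fun i => by simp [Y, pderiv_X]
  simp only [secondOrder_apply, mul_finsum, Derivation.leibniz, h0, hΔ, mul_zero, add_zero,
    smul_eq_mul, mul_smul_comm]

theorem secondOrder_P_mul (Δ : ℕ → Derivation K R R) (k : ℕ) (f : R) :
    secondOrder Δ (P k * f) = P k * secondOrder Δ f + (k : K) • Δ k f +
      ∑ᶠ i : ℕ, (i : K) • (Δ i (P k) * pderiv (Var.p i) f) := by
  have h0 : ∀ i : ℕ, (i : K) • Δ i (pderiv (Var.p i) (P k * f)) =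
      P k * ((i : K) • Δ i (pderiv (Var.p i) f)) + (if i = k then (i : K) • Δ i f else 0) +
        (i : K) • (Δ i (P k) * pderiv (Var.p i) f) := by
    intro i
    rw [Derivation.leibniz, map_add]
    by_cases h : i = k
    · subst h
      simp [P, mul_comm]
      ring
    · have : pderiv (Var.p i) (P k) = 0 := by
        rw [P, pderiv_X_of_ne]
        exact fun h' => h (Var.p.inj h').symm
      simp [this, h, mul_comm]
  have hs1 : (fun i : ℕ => P k * ((i : K) • Δ i (pderiv (Var.p i) f))).HasFiniteSupport :=
    hasFiniteSupport_of_pderiv f fun i h => by simp [h]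
  have hs2 : (fun i => if i = k then (i : K) • Δ i f else 0).HasFiniteSupport :=
    (Set.finite_singleton k).subset fun i hi => by
      by_contra h
      exact hi (if_neg h)
  have hs3 : (fun i : ℕ => (i : K) • (Δ i (P k) * pderiv (Var.p i) f)).HasFiniteSupport :=
    hasFiniteSupport_of_pderiv f fun i h => by simp [h]
  rw [secondOrder_apply, finsum_congr h0, finsum_add_distrib _ hs3, finsum_add_distrib hs1 hs2,
    ← mul_finsum, finsum_eq_single _ k fun i hi => if_neg hi, if_pos rfl, secondOrder_apply]
  exact (hs1.union hs2).subset (Function.support_add _ _)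

theorem secondOrder_P_mul_of_eq_zero (Δ : ℕ → Derivation K R R) (k : ℕ)
    (hΔ : ∀ i, Δ i (P k) = 0) (f : R) :
    secondOrder Δ (P k * f) = P k * secondOrder Δ f + (k : K) • Δ k f := by
  simp [secondOrder_P_mul, hΔ]

/-- The power sum `p_n`, with the convention `p_0 = 0`. -/
def Q : ℕ → R
  | 0 => 0
  | n + 1 => P (n + 1)

@[simp] theorem Q_zero : Q 0 = 0 := rfl

theorem Q_succ (n : ℕ) : Q (n + 1) = P (n + 1) := rfl

/-- The derivation sending `p_n` to `u n` and `y_n` to `v n`. -/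
def derivPY (u v : ℕ → R) : Derivation K R R :=
  mkDerivation K fun
    | Var.p n => u n
    | Var.y n => v n

@[simp] theorem derivPY_P (u v : ℕ → R) (n : ℕ) : derivPY u v (P n) = u n :=
  mkDerivation_X _ _ _

@[simp] theorem derivPY_Y (u v : ℕ → R) (n : ℕ) : derivPY u v (Y n) = v n :=
  mkDerivation_X _ _ _

/-- The derivation `Σ_i i·p_{i+k}·∂/∂p_i`. -/
def pShift (k : ℕ) : Derivation K R R := derivPY (fun i => (i : K) • P (i + k)) 0

/-- The derivation `Σ_i y_{i+k}·∂/∂y_i`. -/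
def yShift (k : ℕ) : Derivation K R R := derivPY 0 fun i => Y (i + k)

/-- The derivation `Σ_i i·y_{i+k}·∂/∂y_i`. -/
def yEuler (k : ℕ) : Derivation K R R := derivPY 0 fun i => (i : K) • Y (i + k)

@[simp] theorem pShift_P (k n : ℕ) : pShift k (P n) = (n : K) • P (n + k) := derivPY_P _ _ _
@[simp] theorem pShift_Y (k n : ℕ) : pShift k (Y n) = 0 := derivPY_Y _ _ _
@[simp] theorem yShift_P (k n : ℕ) : yShift k (P n) = 0 := derivPY_P _ _ _
@[simp] theorem yShift_Y (k n : ℕ) : yShift k (Y n) = Y (n + k) := derivPY_Y _ _ _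
@[simp] theorem yEuler_P (k n : ℕ) : yEuler k (P n) = 0 := derivPY_P _ _ _
@[simp] theorem yEuler_Y (k n : ℕ) : yEuler k (Y n) = (n : K) • Y (n + k) := derivPY_Y _ _ _

/-- The first-order part of `Λ_Y`. -/
def lamDeriv : Derivation K R R :=
  derivPY 0 fun m => ∑ x ∈ antidiagonal m, Y x.1 * Q x.2 + (bb * m) • Y m

/-- The first-order part of `2 D_α`. -/
def laplaceDeriv : Derivation K R R :=
  derivPY (fun n => (n : K) • ∑ x ∈ antidiagonal n, Q x.1 * Q x.2 + (bb * (n * (n - 1))) • P n) 0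

/-- The first-order part of `twoE`. -/
def twoEDeriv : Derivation K R R :=
  derivPY 0 fun m =>
    (2 : K) • ∑ x ∈ antidiagonal m, (x.1 : K) • (Y x.1 * Q x.2) + (bb * (m * (m - 1))) • Y m

/-- `Λ_Y` as a linear map. -/
def lamMap : R →ₗ[K] R := alpha • secondOrder yShift + (lamDeriv : R →ₗ[K] R)

/-- `2 D_α` as a linear map. -/
def twoD : R →ₗ[K] R := alpha • secondOrder pShift + (laplaceDeriv : R →ₗ[K] R)

/-- Twice the operator which has to be added to `D_α` to make it commute with `Λ_Y`
on polynomials linear in the `y_i`. -/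
def twoE : R →ₗ[K] R := (2 * alpha) • secondOrder yEuler + (twoEDeriv : R →ₗ[K] R)

theorem injective_p_add (k : ℕ) : Function.Injective fun n => Var.p (n + k) := fun a b h => by
  have := Var.p.inj h
  omega

theorem injective_y_add (k : ℕ) : Function.Injective fun n => Var.y (n + k) := fun a b h => by
  have := Var.y.inj h
  omega

theorem finsum_mul_dP (u : ℕ → R) (hu : u 0 = 0) (f : R) :
    ∑ᶠ j, u (j + 1) * dP (j + 1) f = derivPY u 0 f := by
  refine finsum_mul_pderiv _ (injective_p_add 1) (fun j => u (j + 1)) _ (fun j => rfl)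
    (fun v hv => ?_) f
  rcases v with (_ | n) | n
  · exact hu
  · exact absurd ⟨n, rfl⟩ hv
  · rfl

theorem finsum_mul_pderiv_p (u : ℕ → R) (f : R) :
    ∑ᶠ j, u j * pderiv (Var.p j) f = derivPY u 0 f := by
  refine finsum_mul_pderiv _ (injective_p_add 0) u _ (fun j => rfl) (fun v hv => ?_) f
  rcases v with n | n
  · exact absurd ⟨n, rfl⟩ hv
  · rfl

theorem finsum_mul_dY (u : ℕ → R) (f : R) : ∑ᶠ j, u j * dY j f = derivPY 0 u f := by
  refine finsum_mul_pderiv _ (injective_y_add 0) u _ (fun j => rfl) (fun v hv => ?_) f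
  rcases v with n | n
  · rfl
  · exact absurd ⟨n, rfl⟩ hv

theorem finsum_mul_dY_succ (u : ℕ → R) (hu : u 0 = 0) (f : R) :
    ∑ᶠ j, u (j + 1) * dY (j + 1) f = derivPY 0 u f := by
  rw [← finsum_mul_dY, finsum_succ_eq (fun j => u j * dY j f) (by simp [hu])]

theorem finsum_mul_dP_add_two (a : ℕ → ℕ → R) (u : ℕ → R) (h0 : u 0 = 0) (h1 : u 1 = 0)
    (hu : ∀ n, u (n + 2) = ∑ x ∈ antidiagonal n, a x.1 x.2) (f : R) :
    ∑ᶠ (i : ℕ) (j : ℕ), a i j * dP (i + j + 2) f = derivPY u 0 f := by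
  refine finsum_mul_pderiv_add _ (injective_p_add 2) a _ hu (fun v hv => ?_) f
  rcases v with (_ | _ | n) | n
  · exact h0
  · exact h1
  · exact absurd ⟨n, rfl⟩ hv
  · rfl

theorem finsum_mul_dY_add_one (a : ℕ → ℕ → R) (u : ℕ → R) (h0 : u 0 = 0)
    (hu : ∀ n, u (n + 1) = ∑ x ∈ antidiagonal n, a x.1 x.2) (f : R) :
    ∑ᶠ (i : ℕ) (j : ℕ), a i j * dY (i + j + 1) f = derivPY 0 u f := by
  refine finsum_mul_pderiv_add _ (injective_y_add 1) a _ hu (fun v hv => ?_) f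
  rcases v with n | _ | n
  · rfl
  · exact h0
  · exact absurd ⟨n, rfl⟩ hv

theorem LamY_eq (f : R) : LamY f = lamMap f := by
  have h1 : ∑ᶠ (i : ℕ) (j : ℕ), ((i + 1 : ℕ) : K) • (Y (i + j + 1) * dP (i + 1) (dY j f)) =
      secondOrder yShift f := by
    refine (finsum_congr fun i => ?_).trans
      (finsum_succ_eq (fun i : ℕ => (i : K) • yShift i (pderiv (Var.p i) f)) (by simp))
    rw [← smul_finsum]
    congr 1
    simp only [dP, dY, pderiv_comm (Var.p (i + 1))]
    refine (finsum_congr fun j => ?_).trans (finsum_mul_dY (fun j => Y (j + (i + 1))) _)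
    rw [dY, add_right_comm, add_comm, add_comm i]
  have h2 : ∑ᶠ (i : ℕ) (j : ℕ), Y i * P (j + 1) * dY (i + j + 1) f =
      derivPY 0 (fun m => ∑ x ∈ antidiagonal m, Y x.1 * Q x.2) f :=
    finsum_mul_dY_add_one (fun i j => Y i * P (j + 1)) _ (by simp)
      (fun n => by simp [Finset.Nat.sum_antidiagonal_succ', Q_succ]) f
  have h3 : ∑ᶠ i : ℕ, ((i + 1 : ℕ) : K) • (Y (i + 1) * dY (i + 1) f) =
      derivPY 0 (fun m => (m : K) • Y m) f := by
    simp only [← smul_mul_assoc]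
    exact finsum_mul_dY_succ (fun m => (m : K) • Y m) (by simp) f
  have h4 : lamDeriv = derivPY 0 (fun m => ∑ x ∈ antidiagonal m, Y x.1 * Q x.2) +
      bb • derivPY 0 (fun m => (m : K) • Y m) := by
    refine derivation_ext fun v => ?_
    rcases v with n | n <;> simp [lamDeriv, derivPY, mkDerivation_X, mul_smul]
  rw [LamY, h1, h2, h3, lamMap, h4]
  simp [add_assoc]

theorem Dalpha_eq (f : R) : Dalpha f = (2 : K)⁻¹ • twoD f := by
  have h1 : ∑ᶠ (i : ℕ) (j : ℕ), (((i + 1) * (j + 1) : ℕ) : K) •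
      (P (i + 1 + (j + 1)) * dP (i + 1) (dP (j + 1) f)) = secondOrder pShift f := by
    refine (finsum_congr fun i => ?_).trans
      (finsum_succ_eq (fun i : ℕ => (i : K) • pShift i (pderiv (Var.p i) f)) (by simp))
    simp only [Nat.cast_mul, mul_smul]
    rw [← smul_finsum]
    congr 1
    simp only [dP, pderiv_comm (Var.p (i + 1)), ← smul_mul_assoc]
    refine (finsum_congr fun j => ?_).trans
      (finsum_mul_dP (fun j => (j : K) • P (j + (i + 1))) (by simp) _)
    rw [dP, add_comm (i + 1)]
  have h2 : ∑ᶠ (i : ℕ) (j : ℕ), (((i + 1) + (j + 1) : ℕ) : K) •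
        (P (i + 1) * P (j + 1) * dP (i + 1 + (j + 1)) f) =
      derivPY (fun n => (n : K) • ∑ x ∈ antidiagonal n, Q x.1 * Q x.2) 0 f := by
    simp only [← smul_mul_assoc, show ∀ i j : ℕ, i + 1 + (j + 1) = i + j + 2 by intros; ring]
    refine finsum_mul_dP_add_two
      (fun i j => ((i + j + 2 : ℕ) : K) • P (i + 1) * P (j + 1)) _ (by simp)
      (by simp [Finset.Nat.sum_antidiagonal_succ]) (fun n => ?_) f
    simp only [Finset.Nat.sum_antidiagonal_succ' (n := n + 1),
      Finset.Nat.sum_antidiagonal_succ (n := n), Q_succ, Q_zero, mul_zero, zero_mul, zero_add,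
      Finset.smul_sum]
    refine Finset.sum_congr rfl fun x hx => ?_
    rw [Finset.HasAntidiagonal.mem_antidiagonal.1 hx, smul_mul_assoc]
  have h3 : ∑ᶠ i : ℕ, (((i + 1) * i : ℕ) : K) • (P (i + 1) * dP (i + 1) f) =
      derivPY (fun n => ((n : K) * (n - 1)) • P n) 0 f := by
    simp only [← smul_mul_assoc]
    refine (finsum_congr fun i => ?_).trans
      (finsum_mul_dP (fun n => ((n : K) * (n - 1)) • P n) (by simp) f)
    simp
  have h4 : laplaceDeriv =
      derivPY (fun n => (n : K) • ∑ x ∈ antidiagonal n, Q x.1 * Q x.2) 0 +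
        bb • derivPY (fun n => ((n : K) * (n - 1)) • P n) 0 := by
    refine derivation_ext fun v => ?_
    rcases v with n | n <;> simp [laplaceDeriv, derivPY, mkDerivation_X, mul_smul]
  rw [Dalpha, h1, h2, h3, twoD, h4]
  simp [add_assoc]

theorem Yplus_eq (f : R) : Yplus f = yShift 1 f := finsum_mul_dY _ f

theorem ThetaY_eq (f : R) : ThetaY f = derivPY 0 Q f := finsum_mul_dY_succ Q rfl f

theorem yShift_P_mul (k l : ℕ) (f : R) : yShift k (P l * f) = P l * yShift k f := by simp

theorem yEuler_P_mul (k l : ℕ) (f : R) : yEuler k (P l * f) = P l * yEuler k f := by simp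

theorem pShift_P_mul (k l : ℕ) (f : R) :
    pShift k (P l * f) = P l * pShift k f + (l : K) • (P (l + k) * f) := by
  simp [mul_comm f]

theorem lamMap_P_mul (k : ℕ) (f : R) :
    lamMap (P k * f) = P k * lamMap f + (alpha * k) • yShift k f := by
  have h : lamDeriv (P k) = 0 := derivPY_P _ _ _
  simp only [lamMap, LinearMap.add_apply, LinearMap.smul_apply, Derivation.coeFn_coe,
    secondOrder_P_mul_of_eq_zero yShift k fun i => yShift_P i k, Derivation.leibniz, h,
    smul_eq_mul, mul_zero, smul_eq_C_mul, map_mul]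
  ring

theorem twoE_P_mul (k : ℕ) (f : R) :
    twoE (P k * f) = P k * twoE f + (2 * alpha * k) • yEuler k f := by
  have h : twoEDeriv (P k) = 0 := derivPY_P _ _ _
  simp only [twoE, LinearMap.add_apply, LinearMap.smul_apply, Derivation.coeFn_coe,
    secondOrder_P_mul_of_eq_zero yEuler k fun i => yEuler_P i k, Derivation.leibniz, h,
    smul_eq_mul, mul_zero, smul_eq_C_mul, map_mul]
  ring

/-- The commutator of `twoD` with multiplication by `p_k`. -/
def bracketD (k : ℕ) : R →ₗ[K] R :=
  (2 * alpha * k) • (pShift k : R →ₗ[K] R) + LinearMap.mulLeft K (laplaceDeriv (P k))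

theorem bracketD_apply (k : ℕ) (f : R) :
    bracketD k f = (2 * alpha * k) • pShift k f + laplaceDeriv (P k) * f := rfl

theorem twoD_P_mul (k : ℕ) (f : R) : twoD (P k * f) = P k * twoD f + bracketD k f := by
  have h : ∑ᶠ i : ℕ, (i : K) • (pShift i (P k) * pderiv (Var.p i) f) = (k : K) • pShift k f := by
    rw [show pShift k f = _ from (finsum_mul_pderiv_p _ f).symm, smul_finsum]
    refine finsum_congr fun i => ?_
    rw [pShift_P, add_comm k, smul_mul_assoc, smul_mul_assoc, smul_comm]
  simp only [twoD, LinearMap.add_apply, LinearMap.smul_apply, Derivation.coeFn_coe,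
    secondOrder_P_mul, h, Derivation.leibniz, bracketD_apply, smul_eq_mul]
  simp only [smul_eq_C_mul, map_mul, map_ofNat]
  ring

/-- The commutator of `twoD + twoE` with multiplication by `p_k`. -/
def bracketH (k : ℕ) : R →ₗ[K] R := bracketD k + (2 * alpha * k) • (yEuler k : R →ₗ[K] R)

theorem bracketH_apply (k : ℕ) (f : R) :
    bracketH k f = (2 * alpha * k) • pShift k f + laplaceDeriv (P k) * f +
      (2 * alpha * k) • yEuler k f := rfl

/-- The operator `2 D_α + twoE`, which commutes with `Λ_Y` on polynomials linear in the `y_i`. -/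
def twoH : R →ₗ[K] R := twoD + twoE

theorem twoH_P_mul (k : ℕ) (f : R) : twoH (P k * f) = P k * twoH f + bracketH k f := by
  simp only [twoH, LinearMap.add_apply, twoD_P_mul, twoE_P_mul, bracketH, LinearMap.smul_apply,
    Derivation.coeFn_coe]
  ring

theorem bracketD_P_mul (k l : ℕ) (f : R) :
    bracketD k (P l * f) = P l * bracketD k f + (2 * alpha * k * l) • (P (l + k) * f) := by
  simp only [bracketD_apply, pShift_P_mul, smul_eq_C_mul, map_mul]
  ring

theorem bracketH_P_mul (k l : ℕ) (f : R) :
    bracketH k (P l * f) = P l * bracketH k f + (2 * alpha * k * l) • (P (l + k) * f) := by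
  simp only [bracketH, LinearMap.add_apply, bracketD_P_mul, LinearMap.smul_apply,
    Derivation.coeFn_coe, yEuler_P_mul, smul_eq_C_mul, map_mul]
  ring

theorem laplaceDeriv_P (k : ℕ) : laplaceDeriv (P k) =
    (k : K) • ∑ x ∈ antidiagonal k, Q x.1 * Q x.2 + (bb * (k * (k - 1))) • P k :=
  derivPY_P _ _ _

theorem derivPY_zero_Q (v : ℕ → R) (k : ℕ) : derivPY 0 v (Q k) = 0 := by
  cases k with
  | zero => simp
  | succ k => exact derivPY_P _ _ _

theorem derivPY_zero_laplaceDeriv (v : ℕ → R) (k : ℕ) :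
    derivPY 0 v (laplaceDeriv (P k)) = 0 := by
  rw [laplaceDeriv_P, map_add, Derivation.map_smul, Derivation.map_smul, map_sum, derivPY_P]
  simp [derivPY_zero_Q]

theorem yEuler_yShift (k l : ℕ) (f : R) :
    yEuler k (yShift l f) = yShift l (yEuler k f) + (l : K) • yShift (l + k) f := by
  have h : ⁅yEuler k, yShift l⁆ = (l : K) • yShift (l + k) := by
    refine derivation_ext fun v => ?_
    rcases v with n | n
    · change ⁅yEuler k, yShift l⁆ (P n) = (l : K) • yShift (l + k) (P n)
      simp [Derivation.commutator_apply]
    · change ⁅yEuler k, yShift l⁆ (Y n) = (l : K) • yShift (l + k) (Y n)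
      simp [Derivation.commutator_apply, add_smul, add_assoc, add_comm k]
  rw [← sub_eq_iff_eq_add', ← Derivation.commutator_apply, h]
  rfl

theorem pShift_yShift (k l : ℕ) (f : R) : pShift k (yShift l f) = yShift l (pShift k f) := by
  have h : ⁅pShift k, yShift l⁆ = 0 := by
    refine derivation_ext fun v => ?_
    rcases v with n | n
    · change ⁅pShift k, yShift l⁆ (P n) = 0
      simp [Derivation.commutator_apply]
    · change ⁅pShift k, yShift l⁆ (Y n) = 0
      simp [Derivation.commutator_apply]
  rw [← sub_eq_zero, ← Derivation.commutator_apply, h, Derivation.zero_apply]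

theorem bracketH_yShift (k l : ℕ) (f : R) :
    bracketH k (yShift l f) = yShift l (bracketH k f) +
      (2 * alpha * k * l) • yShift (l + k) f := by
  have h : yShift l (laplaceDeriv (P k)) = 0 := derivPY_zero_laplaceDeriv _ k
  simp only [bracketH_apply, pShift_yShift, yEuler_yShift, map_add, Derivation.map_smul,
    Derivation.leibniz, h, smul_eq_mul]
  simp only [smul_eq_C_mul, map_mul]
  ring

theorem lamMap_Q_mul (k : ℕ) (f : R) :
    lamMap (Q k * f) = Q k * lamMap f + (alpha * k) • yShift k f := by
  cases k with
  | zero => simp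
  | succ k => exact lamMap_P_mul _ f

theorem bracketH_zero (f : R) : bracketH 0 f = 0 := by
  simp [bracketH_apply, laplaceDeriv_P]

theorem twoH_Q_mul (k : ℕ) (f : R) : twoH (Q k * f) = Q k * twoH f + bracketH k f := by
  cases k with
  | zero => simp [bracketH_zero]
  | succ k => exact twoH_P_mul _ f

theorem bracketH_Q_mul (k l : ℕ) (f : R) :
    bracketH k (Q l * f) = Q l * bracketH k f + (2 * alpha * k * l) • (Q (l + k) * f) := by
  cases l with
  | zero => simp
  | succ l =>
    have h : l + 1 + k = l + k + 1 := by ring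
    rw [h, Q_succ, Q_succ, bracketH_P_mul, h]

theorem lamMap_Y (m : ℕ) :
    lamMap (Y m) = ∑ x ∈ antidiagonal m, Y x.1 * Q x.2 + (bb * m) • Y m := by
  rw [lamMap, LinearMap.add_apply, LinearMap.smul_apply, secondOrder_Y, smul_zero, zero_add]
  exact derivPY_Y _ _ _

theorem twoH_Y (m : ℕ) : twoH (Y m) =
    (2 : K) • ∑ x ∈ antidiagonal m, (x.1 : K) • (Y x.1 * Q x.2) + (bb * (m * (m - 1))) • Y m := by
  have h1 : twoD (Y m) = 0 := by
    rw [twoD, LinearMap.add_apply, LinearMap.smul_apply, secondOrder_Y, smul_zero, zero_add]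
    exact derivPY_Y _ _ _
  rw [twoH, LinearMap.add_apply, h1, zero_add, twoE, LinearMap.add_apply, LinearMap.smul_apply,
    secondOrder_Y, smul_zero, zero_add]
  exact derivPY_Y _ _ _

theorem bracketH_Y (k m : ℕ) :
    bracketH k (Y m) = laplaceDeriv (P k) * Y m + (2 * alpha * k * m) • Y (m + k) := by
  simp [bracketH_apply, mul_smul]

theorem sum_antidiagonal_assoc {M : Type*} [AddCommMonoid M] (F : ℕ → ℕ → ℕ → M) (n : ℕ) :
    ∑ x ∈ antidiagonal n, ∑ z ∈ antidiagonal x.1, F z.1 z.2 x.2 =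
      ∑ x ∈ antidiagonal n, ∑ z ∈ antidiagonal x.2, F x.1 z.1 z.2 := by
  rw [Finset.sum_sigma', Finset.sum_sigma']
  refine Finset.sum_nbij' (fun x => ⟨(x.2.1, x.2.2 + x.1.2), (x.2.2, x.1.2)⟩)
    (fun x => ⟨(x.1.1 + x.2.1, x.2.2), (x.1.1, x.2.1)⟩) ?_ ?_ ?_ ?_ ?_
  · rintro ⟨⟨a, b⟩, c, d⟩ h
    simp only [Finset.mem_sigma, Finset.HasAntidiagonal.mem_antidiagonal] at h ⊢
    exact ⟨by omega, trivial⟩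
  · rintro ⟨⟨a, b⟩, c, d⟩ h
    simp only [Finset.mem_sigma, Finset.HasAntidiagonal.mem_antidiagonal] at h ⊢
    exact ⟨by omega, trivial⟩
  · rintro ⟨⟨a, b⟩, c, d⟩ h
    simp only [Finset.mem_sigma, Finset.HasAntidiagonal.mem_antidiagonal] at h
    obtain ⟨-, rfl⟩ := h
    rfl
  · rintro ⟨⟨a, b⟩, c, d⟩ h
    simp only [Finset.mem_sigma, Finset.HasAntidiagonal.mem_antidiagonal] at h
    obtain ⟨-, rfl⟩ := h
    rfl
  · rintro ⟨⟨a, b⟩, c, d⟩ h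
    rfl

theorem sum_antidiagonal_shift (u q : ℕ → R) (m k : ℕ) :
    ∑ x ∈ antidiagonal m, (x.2 : R) * (q (x.2 + k) * u x.1) +
        ∑ x ∈ antidiagonal (m + k), (x.1 : R) * (u x.1 * q x.2) =
      ∑ x ∈ antidiagonal k, (x.1 : R) * (q x.2 * u (m + x.1)) +
        (m : R) * ∑ x ∈ antidiagonal (m + k), u x.1 * q x.2 := by
  rw [← sub_eq_iff_eq_add, add_sub_assoc, Finset.mul_sum, ← Finset.sum_sub_distrib]
  simp only [Finset.Nat.sum_antidiagonal_eq_sum_range_succ_mk]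
  rw [Nat.succ_eq_add_one, Nat.succ_eq_add_one, Nat.succ_eq_add_one, add_assoc,
    Finset.sum_range_add _ m (k + 1), Finset.sum_range_succ _ m, ← add_assoc]
  simp only [Nat.sub_self, Nat.cast_zero, zero_mul, add_zero]
  rw [← Finset.sum_add_distrib, Finset.sum_eq_zero, zero_add]
  · refine Finset.sum_congr rfl fun i hi => ?_
    rw [Nat.add_sub_add_left]
    push_cast
    ring
  · intro i hi
    have h : i ≤ m := (Finset.mem_range.1 hi).le
    rw [Nat.sub_add_comm h, Nat.cast_sub h]
    ring

theorem sum_antidiagonal_mul_symm (q : ℕ → R) (n : ℕ) :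
    (2 : R) * ∑ x ∈ antidiagonal n, (x.1 : R) * (q x.1 * q x.2) =
      (n : R) * ∑ x ∈ antidiagonal n, q x.1 * q x.2 := by
  have h := Finset.Nat.sum_antidiagonal_swap (n := n) (f := fun x => (x.1 : R) * (q x.1 * q x.2))
  rw [two_mul]
  nth_rewrite 1 [← h]
  rw [← Finset.sum_add_distrib, Finset.mul_sum]
  refine Finset.sum_congr rfl fun x hx => ?_
  rw [← Finset.HasAntidiagonal.mem_antidiagonal.1 hx]
  simp only [Prod.fst_swap, Prod.snd_swap]
  push_cast
  ring

theorem lamMap_Q_mul_Q_mul (i j : ℕ) (f : R) :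
    lamMap (Q i * Q j * f) = Q i * Q j * lamMap f +
      C alpha * ((j : R) * (Q i * yShift j f) + (i : R) * (Q j * yShift i f)) := by
  have h : yShift i (Q j) = 0 := derivPY_zero_Q _ j
  rw [mul_assoc, lamMap_Q_mul, lamMap_Q_mul, Derivation.leibniz, h, smul_zero, add_zero]
  simp only [smul_eq_C_mul, map_mul, map_natCast, smul_eq_mul]
  ring

theorem lamMap_laplaceDeriv_mul (k : ℕ) (f : R) :
    lamMap (laplaceDeriv (P k) * f) = laplaceDeriv (P k) * lamMap f +
      C (alpha * k) * (2 * ∑ x ∈ antidiagonal k, (x.1 : R) * (Q x.2 * yShift x.1 f) +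
        C (bb * (k * (k - 1))) * yShift k f) := by
  have hs := Finset.Nat.sum_antidiagonal_swap (n := k)
    (f := fun x => (x.1 : R) * (Q x.2 * yShift x.1 f))
  simp only [Prod.fst_swap, Prod.snd_swap] at hs
  have h : lamMap ((∑ x ∈ antidiagonal k, Q x.1 * Q x.2) * f) =
      (∑ x ∈ antidiagonal k, Q x.1 * Q x.2) * lamMap f +
        C alpha * (2 * ∑ x ∈ antidiagonal k, (x.1 : R) * (Q x.2 * yShift x.1 f)) := by
    simp only [Finset.sum_mul, map_sum, lamMap_Q_mul_Q_mul, Finset.sum_add_distrib,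
      ← Finset.mul_sum, hs, two_mul]
  rw [laplaceDeriv_P, add_mul, smul_mul_assoc, smul_mul_assoc, map_add, map_smul, map_smul, h,
    lamMap_P_mul]
  simp only [smul_eq_C_mul, map_mul]
  ring

/-- The commutator of `[twoH, Λ_Y]` with multiplication by `p_k`. -/
def bracketHLam (k : ℕ) : R →ₗ[K] R :=
  bracketH k ∘ₗ lamMap - lamMap ∘ₗ bracketH k +
    (alpha * k) • (twoH ∘ₗ (yShift k : R →ₗ[K] R) - (yShift k : R →ₗ[K] R) ∘ₗ twoH)

theorem bracketHLam_apply (k : ℕ) (f : R) :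
    bracketHLam k f = bracketH k (lamMap f) - lamMap (bracketH k f) +
      (alpha * k) • (twoH (yShift k f) - yShift k (twoH f)) := rfl

theorem bracketHLam_P_mul (k l : ℕ) (f : R) :
    bracketHLam k (P l * f) = P l * bracketHLam k f := by
  have h1 := bracketH_yShift k l f
  have h2 := bracketH_yShift l k f
  rw [add_comm k l] at h2
  simp only [bracketHLam_apply, lamMap_P_mul, bracketH_P_mul, twoH_P_mul, yShift_P_mul, map_add,
    map_smul, h1, h2]
  simp only [smul_eq_C_mul, map_mul, Nat.cast_add, map_add]
  ring

theorem bracketHLam_Y (k m : ℕ) : bracketHLam k (Y m) = 0 := by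
  have h1 : bracketH k (lamMap (Y m)) =
      laplaceDeriv (P k) * lamMap (Y m) + C (2 * alpha * k) *
        (∑ x ∈ antidiagonal m, (x.1 : R) * (Y (x.1 + k) * Q x.2) +
          ∑ x ∈ antidiagonal m, (x.2 : R) * (Q (x.2 + k) * Y x.1) +
          C (bb * m * m) * Y (m + k)) := by
    rw [lamMap_Y, map_add, map_sum, map_smul, mul_add (laplaceDeriv (P k)), Finset.mul_sum,
      mul_add (C (2 * alpha * k)), mul_add (C (2 * alpha * k)), Finset.mul_sum, Finset.mul_sum,
      bracketH_Y]
    have h : ∀ x ∈ antidiagonal m, bracketH k (Y x.1 * Q x.2) =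
        laplaceDeriv (P k) * (Y x.1 * Q x.2) +
          C (2 * alpha * k) * ((x.1 : R) * (Y (x.1 + k) * Q x.2)) +
          C (2 * alpha * k) * ((x.2 : R) * (Q (x.2 + k) * Y x.1)) := fun x _ => by
      rw [mul_comm (Y x.1), bracketH_Q_mul, bracketH_Y]
      simp only [smul_eq_C_mul, map_mul, map_natCast]
      ring
    rw [Finset.sum_congr rfl h, Finset.sum_add_distrib, Finset.sum_add_distrib]
    simp only [smul_eq_C_mul, map_mul]
    ring
  have h2 := sum_antidiagonal_shift Y Q m k
  rw [bracketHLam_apply, h1, bracketH_Y, map_add, map_smul, lamMap_laplaceDeriv_mul,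
    yShift_Y, lamMap_Y (m + k), twoH_Y, twoH_Y, map_add, Derivation.map_smul, map_sum,
    Derivation.map_smul, yShift_Y]
  have h : ∀ x ∈ antidiagonal m, yShift k ((x.1 : K) • (Y x.1 * Q x.2)) =
      (x.1 : R) * (Y (x.1 + k) * Q x.2) := fun x _ => by
    have hQ : yShift k (Q x.2) = 0 := derivPY_zero_Q _ _
    rw [Derivation.map_smul, Derivation.leibniz, hQ, yShift_Y, smul_zero, zero_add, smul_eq_mul,
      smul_eq_C_mul, map_natCast, mul_comm (Q _)]
  rw [Finset.sum_congr rfl h]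
  simp only [yShift_Y, smul_eq_C_mul, map_mul, map_natCast, map_sub, map_one, map_ofNat,
    Nat.cast_add, map_add]
  linear_combination (2 * C alpha * (k : R)) * h2

theorem twoH_lamMap_Y (m : ℕ) : twoH (lamMap (Y m)) = lamMap (twoH (Y m)) := by
  have h1 : twoH (lamMap (Y m)) = ∑ x ∈ antidiagonal m, (Q x.2 * twoH (Y x.1) +
      laplaceDeriv (P x.2) * Y x.1 + (2 * alpha * x.2 * x.1) • Y m) + (bb * m) • twoH (Y m) := by
    rw [lamMap_Y, map_add, map_sum, map_smul]
    congr 1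
    refine Finset.sum_congr rfl fun x hx => ?_
    rw [mul_comm, twoH_Q_mul, bracketH_Y, Finset.HasAntidiagonal.mem_antidiagonal.1 hx, add_assoc]
  have h2 : lamMap (twoH (Y m)) = ∑ x ∈ antidiagonal m, (C (2 * x.1 : K) * (Q x.2 * lamMap (Y x.1)) +
      (2 * alpha * x.2 * x.1) • Y m) + (bb * (m * (m - 1))) • lamMap (Y m) := by
    rw [twoH_Y, map_add, map_smul, map_smul, map_sum, Finset.smul_sum]
    congr 1
    refine Finset.sum_congr rfl fun x hx => ?_
    rw [map_smul, mul_comm (Y _), lamMap_Q_mul, yShift_Y,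
      Finset.HasAntidiagonal.mem_antidiagonal.1 hx]
    simp only [smul_eq_C_mul, map_mul]
    ring
  have hP : ∀ j : ℕ, C ((bb * (j * (j - 1)) : K)) * P j = C (bb * (j * (j - 1)) : K) * Q j := by
    intro j
    cases j <;> simp [Q]
  have h3 : ∑ x ∈ antidiagonal m, ∑ z ∈ antidiagonal x.1,
        ((2 * (z.1 : R) - 2 * (z.1 + z.2)) * (Y z.1 * Q z.2 * Q x.2)) +
      ∑ x ∈ antidiagonal m, ∑ z ∈ antidiagonal x.2, (((z.1 : R) + z.2) * (Y x.1 * Q z.1 * Q z.2)) =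
      0 := by
    rw [sum_antidiagonal_assoc fun a b c =>
      (2 * (a : R) - 2 * (a + b)) * (Y a * Q b * Q c), ← Finset.sum_add_distrib]
    refine Finset.sum_eq_zero fun x _ => ?_
    have hs := Finset.Nat.sum_antidiagonal_swap (n := x.2)
      (f := fun z => (z.1 : R) * (Y x.1 * Q z.1 * Q z.2))
    rw [← Finset.sum_add_distrib]
    refine Eq.trans ?_ (sub_eq_zero.2 hs)
    rw [← Finset.sum_sub_distrib]
    refine Finset.sum_congr rfl fun z _ => ?_
    simp only [Prod.fst_swap, Prod.snd_swap]
    ring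
  have h4 : ∑ x ∈ antidiagonal m, (Q x.2 * twoH (Y x.1) + laplaceDeriv (P x.2) * Y x.1 -
      C (2 * x.1 : K) * (Q x.2 * lamMap (Y x.1))) =
      ∑ x ∈ antidiagonal m, C bb * (((x.1 : R) * ((x.1 : R) - 1) + (x.2 : R) * ((x.2 : R) - 1) - 2 * (x.1 : R) * (x.1 : R)) *
        (Y x.1 * Q x.2)) := by
    rw [← sub_eq_zero, ← Finset.sum_sub_distrib, ← h3, ← Finset.sum_add_distrib]
    refine Finset.sum_congr rfl fun x _ => ?_
    have e1 : ∑ z ∈ antidiagonal x.1, ((2 * (z.1 : R) - 2 * (z.1 + z.2)) * (Y z.1 * Q z.2 * Q x.2)) =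
        Q x.2 * (2 * ∑ z ∈ antidiagonal x.1, (z.1 : R) * (Y z.1 * Q z.2)) -
          2 * (x.1 : R) * (Q x.2 * ∑ z ∈ antidiagonal x.1, Y z.1 * Q z.2) := by
      simp only [Finset.mul_sum, ← Finset.sum_sub_distrib]
      refine Finset.sum_congr rfl fun z hz => ?_
      rw [← Finset.HasAntidiagonal.mem_antidiagonal.1 hz]
      push_cast
      ring
    have e2 : ∑ z ∈ antidiagonal x.2, (((z.1 : R) + z.2) * (Y x.1 * Q z.1 * Q z.2)) =
        (x.2 : R) * (∑ z ∈ antidiagonal x.2, Q z.1 * Q z.2) * Y x.1 := by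
      simp only [Finset.mul_sum, Finset.sum_mul]
      refine Finset.sum_congr rfl fun z hz => ?_
      rw [← Finset.HasAntidiagonal.mem_antidiagonal.1 hz]
      push_cast
      ring
    have hPx := hP x.2
    rw [e1, e2, twoH_Y, lamMap_Y, laplaceDeriv_P]
    simp only [smul_eq_C_mul, map_mul, map_natCast, map_sub, map_one, map_ofNat] at hPx ⊢
    linear_combination Y x.1 * hPx
  have h5 : ∑ x ∈ antidiagonal m, C bb *
        (((x.1 : R) * ((x.1 : R) - 1) + (x.2 : R) * ((x.2 : R) - 1) - 2 * (x.1 : R) * (x.1 : R)) * (Y x.1 * Q x.2)) +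
      (bb * m) • (2 : K) • ∑ x ∈ antidiagonal m, (x.1 : K) • (Y x.1 * Q x.2) -
      (bb * (m * (m - 1))) • ∑ x ∈ antidiagonal m, Y x.1 * Q x.2 = 0 := by
    simp only [smul_eq_C_mul, Finset.mul_sum]
    rw [← Finset.sum_add_distrib, ← Finset.sum_sub_distrib]
    refine Finset.sum_eq_zero fun x hx => ?_
    rw [← Finset.HasAntidiagonal.mem_antidiagonal.1 hx]
    simp only [map_mul, map_natCast, map_sub, map_one, map_ofNat, Nat.cast_add, map_add]
    ring
  rw [h1, h2]
  rw [Finset.sum_sub_distrib, Finset.sum_add_distrib] at h4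
  rw [Finset.sum_add_distrib, Finset.sum_add_distrib, Finset.sum_add_distrib, twoH_Y m,
    lamMap_Y m]
  simp only [smul_eq_C_mul, map_mul] at h4 h5 ⊢
  linear_combination h4 + h5

theorem Psub_induction {p : R → Prop} (hC : ∀ a, p (C a)) (hadd : ∀ f g, p f → p g → p (f + g))
    (hmul : ∀ l, ∀ f ∈ Psub, p f → p (P l * f)) {f : R} (hf : f ∈ Psub) : p f := by
  rw [Psub, supported_eq_range_rename] at hf
  obtain ⟨g, rfl⟩ := hf
  change p (rename _ g)
  induction g using MvPolynomial.induction_on with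
  | C a => rw [rename_C]; exact hC a
  | add g h hg hh => rw [map_add]; exact hadd _ _ hg hh
  | mul_X g v hg =>
    obtain ⟨_, l, rfl⟩ := v
    rw [map_mul, rename_X, mul_comm]
    refine hmul l _ ?_ hg
    rw [Psub, supported_eq_range_rename]
    exact ⟨g, rfl⟩

theorem P_mem_Psub (l : ℕ) : P l ∈ Psub := X_mem_supported.2 ⟨l, rfl⟩

theorem derivPY_zero_of_mem_Psub (v : ℕ → R) {f : R} (hf : f ∈ Psub) : derivPY 0 v f = 0 := by
  refine Psub_induction (p := fun f => derivPY 0 v f = 0) (fun a => derivation_C _ _)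
    (fun f g hf hg => ?_) (fun l f _ hf => ?_) hf
  · rw [map_add, hf, hg, add_zero]
  · rw [Derivation.leibniz, hf, derivPY_P]
    simp

theorem map_Y_mul_eq_zero (Z : R →ₗ[K] R) (m : ℕ) (h0 : Z (Y m) = 0)
    (h : ∀ l, ∀ f ∈ Psub, Z (P l * (Y m * f)) = P l * Z (Y m * f)) {f : R} (hf : f ∈ Psub) :
    Z (Y m * f) = 0 := by
  refine Psub_induction (p := fun f => Z (Y m * f) = 0) (fun a => ?_) (fun f g hf hg => ?_)
    (fun l f hf h' => ?_) hf
  · rw [mul_comm, ← smul_eq_C_mul, map_smul, h0, smul_zero]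
  · rw [mul_add, map_add, hf, hg, add_zero]
  · rw [mul_left_comm, h l f hf, h', mul_zero]

/-- The span of the products `y_i·f` with `f` a polynomial in the `p`-variables. -/
def YP : Submodule K R := Submodule.span K {g | ∃ i, ∃ f ∈ Psub, g = Y i * f}

theorem Y_mul_mem_YP (i : ℕ) {f : R} (hf : f ∈ Psub) : Y i * f ∈ YP :=
  Submodule.subset_span ⟨i, f, hf, rfl⟩

theorem Y_mem_YP (i : ℕ) : Y i ∈ YP := by
  simpa using Y_mul_mem_YP i Psub.one_mem

theorem map_mem_YP (Z : R →ₗ[K] R) (h : ∀ i, ∀ f ∈ Psub, Z (Y i * f) ∈ YP) {g : R}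
    (hg : g ∈ YP) : Z g ∈ YP := by
  have hle : YP ≤ YP.comap Z := by
    refine Submodule.span_le.2 ?_
    rintro _ ⟨i, f, hf, rfl⟩
    exact h i f hf
  exact hle hg

theorem map_eq_zero_of_mem_YP (Z : R →ₗ[K] R) (h : ∀ i, ∀ f ∈ Psub, Z (Y i * f) = 0) {g : R}
    (hg : g ∈ YP) : Z g = 0 := by
  have hle : YP ≤ LinearMap.ker Z := by
    refine Submodule.span_le.2 ?_
    rintro _ ⟨i, f, hf, rfl⟩
    exact h i f hf
  exact hle hg

theorem P_mul_mem_YP (l : ℕ) {g : R} (hg : g ∈ YP) : P l * g ∈ YP :=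
  map_mem_YP (LinearMap.mulLeft K (P l)) (fun i f hf => by
    rw [LinearMap.mulLeft_apply, mul_left_comm]
    exact Y_mul_mem_YP i (Psub.mul_mem (P_mem_Psub l) hf)) hg

theorem yShift_mem_YP (k : ℕ) {g : R} (hg : g ∈ YP) : yShift k g ∈ YP :=
  map_mem_YP (yShift k : R →ₗ[K] R) (fun i f hf => by
    have h : yShift k f = 0 := derivPY_zero_of_mem_Psub _ hf
    rw [Derivation.coeFn_coe, Derivation.leibniz, h, smul_zero, zero_add, yShift_Y, smul_eq_mul,
      mul_comm]
    exact Y_mul_mem_YP _ hf) hg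

theorem Q_mem_Psub (l : ℕ) : Q l ∈ Psub := by
  cases l with
  | zero => exact Psub.zero_mem
  | succ l => exact P_mem_Psub _

theorem lamMap_mem_YP {g : R} (hg : g ∈ YP) : lamMap g ∈ YP := by
  refine map_mem_YP lamMap (fun i f hf => ?_) hg
  have hY : lamMap (Y i) ∈ YP := by
    rw [lamMap_Y]
    exact add_mem (sum_mem fun x _ => Y_mul_mem_YP _ (Q_mem_Psub _))
      (Submodule.smul_mem _ _ (Y_mem_YP i))
  refine Psub_induction (p := fun f => lamMap (Y i * f) ∈ YP) (fun a => ?_)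
    (fun f g hf hg => ?_) (fun l f hf h => ?_) hf
  · rw [mul_comm, ← smul_eq_C_mul, map_smul]
    exact Submodule.smul_mem _ _ hY
  · rw [mul_add, map_add]
    exact add_mem hf hg
  · rw [mul_left_comm, lamMap_P_mul]
    exact add_mem (P_mul_mem_YP l h)
      (Submodule.smul_mem _ _ (yShift_mem_YP l (Y_mul_mem_YP i hf)))

theorem twoH_lamMap {g : R} (hg : g ∈ YP) : twoH (lamMap g) = lamMap (twoH g) := by
  refine sub_eq_zero.1 (map_eq_zero_of_mem_YP (twoH ∘ₗ lamMap - lamMap ∘ₗ twoH)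
    (fun i f hf => map_Y_mul_eq_zero _ i (sub_eq_zero.2 (twoH_lamMap_Y i)) (fun l f hf => ?_) hf) hg)
  have h := map_Y_mul_eq_zero (bracketHLam l) i (bracketHLam_Y l i)
    (fun _ _ _ => bracketHLam_P_mul _ _ _) hf
  rw [bracketHLam_apply] at h
  simp only [LinearMap.sub_apply, LinearMap.comp_apply, lamMap_P_mul, twoH_P_mul, map_add,
    map_smul]
  simp only [smul_eq_C_mul] at h ⊢
  linear_combination h

theorem twoH_lamMap_pow (j : ℕ) {g : R} (hg : g ∈ YP) :
    twoH ((lamMap ^ j) g) = (lamMap ^ j) (twoH g) ∧ (lamMap ^ j) g ∈ YP := by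
  induction j with
  | zero => exact ⟨rfl, hg⟩
  | succ j ih =>
    rw [pow_succ', Module.End.mul_apply, Module.End.mul_apply, twoH_lamMap ih.2, ih.1]
    exact ⟨rfl, lamMap_mem_YP ih.2⟩

/-- The composite `Θ_Y Y_+` as a linear map. -/
def thetaYplus : R →ₗ[K] R := (derivPY 0 Q : R →ₗ[K] R) ∘ₗ (yShift 1 : R →ₗ[K] R)

theorem thetaYplus_P_mul (l : ℕ) (f : R) : thetaYplus (P l * f) = P l * thetaYplus f := by
  simp [thetaYplus]

theorem thetaYplus_Y_mul (m : ℕ) {f : R} (hf : f ∈ Psub) :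
    thetaYplus (Y m * f) = P (m + 1) * f := by
  have h : yShift 1 f = 0 := derivPY_zero_of_mem_Psub _ hf
  simp [thetaYplus, h, derivPY_zero_of_mem_Psub Q hf, Q_succ, mul_comm]

theorem thetaYplus_Y (m : ℕ) : thetaYplus (Y m) = P (m + 1) := by
  simpa using thetaYplus_Y_mul m Psub.one_mem

theorem thetaYplus_laplaceDeriv_mul (k : ℕ) (f : R) :
    thetaYplus (laplaceDeriv (P k) * f) = laplaceDeriv (P k) * thetaYplus f := by
  have h : yShift 1 (laplaceDeriv (P k)) = 0 := derivPY_zero_laplaceDeriv _ _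
  simp [thetaYplus, h, derivPY_zero_laplaceDeriv]

/-- The commutator of `twoD ∘ Θ_Y Y_+ - Θ_Y Y_+ ∘ (twoH + 2 Λ_Y)` with multiplication by `p_k`. -/
def bracketTheta (k : ℕ) : R →ₗ[K] R :=
  bracketD k ∘ₗ thetaYplus - thetaYplus ∘ₗ bracketH k -
    (2 * alpha * k) • (thetaYplus ∘ₗ (yShift k : R →ₗ[K] R))

theorem bracketTheta_apply (k : ℕ) (f : R) : bracketTheta k f =
    bracketD k (thetaYplus f) - thetaYplus (bracketH k f) -
      (2 * alpha * k) • thetaYplus (yShift k f) := rfl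

theorem bracketTheta_P_mul (k l : ℕ) (f : R) :
    bracketTheta k (P l * f) = P l * bracketTheta k f := by
  simp only [bracketTheta_apply, thetaYplus_P_mul, bracketD_P_mul, bracketH_P_mul, yShift_P_mul,
    map_add, map_smul]
  simp only [smul_eq_C_mul]
  ring

theorem bracketTheta_Y (k m : ℕ) : bracketTheta k (Y m) = 0 := by
  rw [bracketTheta_apply, bracketH_Y, map_add, map_smul, thetaYplus_laplaceDeriv_mul,
    thetaYplus_Y, thetaYplus_Y, yShift_Y, thetaYplus_Y, bracketD_apply, pShift_P,
    Nat.add_right_comm m 1]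
  simp only [smul_eq_C_mul, map_mul, map_natCast, Nat.cast_add, Nat.cast_one, map_add, map_one]
  ring

theorem twoD_one : twoD 1 = 0 := by
  simp [twoD, secondOrder_one]

theorem twoD_P (k : ℕ) : twoD (P k) = laplaceDeriv (P k) := by
  simpa [twoD_one, bracketD_apply] using twoD_P_mul k 1

theorem twoD_thetaYplus_Y (m : ℕ) :
    twoD (thetaYplus (Y m)) = thetaYplus (twoH (Y m)) + (2 : K) • thetaYplus (lamMap (Y m)) := by
  have h := sum_antidiagonal_mul_symm Q (m + 1)
  rw [Finset.Nat.sum_antidiagonal_succ, Q_zero, zero_mul, mul_zero, zero_add] at h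
  rw [thetaYplus_Y, twoD_P, laplaceDeriv_P, twoH_Y, lamMap_Y]
  simp only [map_add, map_smul, map_sum, thetaYplus_Y_mul _ (Q_mem_Psub _), thetaYplus_Y]
  simp only [smul_eq_C_mul, map_mul, map_natCast, ← Q_succ] at h ⊢
  rw [← h]
  have e : ∑ x ∈ antidiagonal m, ((x.1 + 1 : ℕ) : R) * (Q (x.1 + 1) * Q x.2) =
      ∑ x ∈ antidiagonal m, (x.1 : R) * (Q (x.1 + 1) * Q x.2) +
        ∑ x ∈ antidiagonal m, Q (x.1 + 1) * Q x.2 := by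
    rw [← Finset.sum_add_distrib]
    refine Finset.sum_congr rfl fun x _ => ?_
    push_cast
    ring
  rw [e]
  simp only [map_sub, map_one, map_ofNat, map_natCast, Nat.cast_add, Nat.cast_one, map_add]
  ring

theorem twoD_thetaYplus {g : R} (hg : g ∈ YP) :
    twoD (thetaYplus g) = thetaYplus (twoH g) + (2 : K) • thetaYplus (lamMap g) := by
  refine sub_eq_zero.1 (map_eq_zero_of_mem_YP
    (twoD ∘ₗ thetaYplus - (thetaYplus ∘ₗ twoH + (2 : K) • (thetaYplus ∘ₗ lamMap)))
    (fun i f hf => map_Y_mul_eq_zero _ i (sub_eq_zero.2 (twoD_thetaYplus_Y i))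
      (fun l f hf => ?_) hf) hg)
  have h := map_Y_mul_eq_zero (bracketTheta l) i (bracketTheta_Y l i)
    (fun _ _ _ => bracketTheta_P_mul _ _ _) hf
  rw [bracketTheta_apply] at h
  simp only [LinearMap.sub_apply, LinearMap.add_apply, LinearMap.smul_apply,
    LinearMap.comp_apply, lamMap_P_mul, twoH_P_mul, thetaYplus_P_mul, twoD_P_mul, map_add,
    map_smul]
  simp only [smul_eq_C_mul, map_mul, map_ofNat] at h ⊢
  linear_combination h

theorem yEuler_Y_zero_mul (k : ℕ) {f : R} (hf : f ∈ Psub) : yEuler k (Y 0 * f) = 0 := by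
  have h : yEuler k f = 0 := derivPY_zero_of_mem_Psub _ hf
  rw [Derivation.leibniz, h, yEuler_Y, Nat.cast_zero, zero_smul, smul_zero, smul_zero, add_zero]

theorem twoE_Y_zero : twoE (Y 0) = 0 := by
  rw [twoE, LinearMap.add_apply, LinearMap.smul_apply, secondOrder_Y, smul_zero, zero_add,
    twoEDeriv, Derivation.coeFn_coe, derivPY_Y]
  simp

theorem twoH_Y_zero_mul {f : R} (hf : f ∈ Psub) : twoH (Y 0 * f) = Y 0 * twoD f := by
  have hE : twoE (Y 0 * f) = 0 := map_Y_mul_eq_zero twoE 0 twoE_Y_zero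
    (fun l f hf => by rw [twoE_P_mul, yEuler_Y_zero_mul l hf, smul_zero, add_zero]) hf
  have hY : laplaceDeriv (Y 0) = 0 := derivPY_Y _ _ _
  rw [twoH, LinearMap.add_apply, hE, add_zero]
  simp only [twoD, LinearMap.add_apply, LinearMap.smul_apply, Derivation.coeFn_coe,
    secondOrder_Y_mul pShift 0 fun i => pShift_Y i 0, Derivation.leibniz, hY, smul_eq_mul,
    mul_zero, add_zero, mul_add, mul_smul_comm]

theorem A_eq (j : ℕ) (f : R) :
    A j f = (1 + bb)⁻¹ • thetaYplus ((lamMap ^ j) (Y 0 * f)) := by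
  have h : LamY = lamMap := funext LamY_eq
  rw [A, h, ThetaY_eq, Yplus_eq, Module.End.pow_apply]
  rfl

theorem A_smul (j : ℕ) (a : K) (f : R) : A j (a • f) = a • A j f := by
  simp only [A_eq, mul_smul_comm, map_smul, smul_comm a]

theorem A_zero {f : R} (hf : f ∈ Psub) : A 0 f = (1 + bb)⁻¹ • (P 1 * f) := by
  rw [A_eq, pow_zero, Module.End.one_apply, thetaYplus_Y_mul 0 hf]

/-- `A (j + 1)` is the commutator `[D_α, A j]` on polynomials in the `p`-variables. -/
theorem A_succ (j : ℕ) {f : R} (hf : f ∈ Psub) :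
    A (j + 1) f = Dalpha (A j f) - A j (Dalpha f) := by
  have hg := twoH_lamMap_pow j (Y_mul_mem_YP 0 hf)
  have h := twoD_thetaYplus hg.2
  rw [hg.1, twoH_Y_zero_mul hf, ← Module.End.mul_apply lamMap, ← pow_succ'] at h
  rw [Dalpha_eq, Dalpha_eq, A_smul, A_eq, A_eq, A_eq, map_smul, h, smul_add, smul_add,
    smul_comm (2 : K)⁻¹ (1 + bb)⁻¹, smul_comm (2 : K)⁻¹ (1 + bb)⁻¹, inv_smul_smul₀ two_ne_zero,
    add_sub_cancel_left]

theorem finite_covers (lam : YoungDiagram) : {mu | Covers lam mu}.Finite := by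
  have hinj : Function.Injective YoungDiagram.cells := fun _ _ h => YoungDiagram.ext h
  refine ((Finset.range (lam.card + 1) ×ˢ
    Finset.range (lam.card + 1)).powerset.finite_toSet.preimage hinj.injOn).subset
    fun mu hmu => ?_
  simp only [Set.mem_preimage, Finset.mem_coe, Finset.mem_powerset]
  rintro ⟨i, j⟩ hij
  have hij : (i, j) ∈ mu := hij
  rw [Finset.mem_product, Finset.mem_range, Finset.mem_range, ← hmu.2]
  constructor
  · refine (YoungDiagram.mem_iff_lt_colLen.1 hij).trans_le ?_
    rw [YoungDiagram.colLen_eq_card]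
    exact Finset.card_le_card (Finset.filter_subset _ _)
  · refine (YoungDiagram.mem_iff_lt_rowLen.1 hij).trans_le ?_
    rw [YoungDiagram.rowLen_eq_card]
    exact Finset.card_le_card (Finset.filter_subset _ _)

theorem finsum_covers {M : Type*} [AddCommMonoid M] (lam : YoungDiagram) (F : YoungDiagram → M) :
    ∑ᶠ (mu : YoungDiagram) (_ : Covers lam mu), F mu = ∑ mu ∈ (finite_covers lam).toFinset, F mu :=
  finsum_mem_eq_finite_toFinset_sum F (finite_covers lam)

/-- **Action of the operators `A_i` on a family satisfying the Jack eigenvalue equation and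
Pieri rule** (Corollary 5.6 of Chapuy–Dołęga). Suppose `(J_λ)` is a family of elements of `𝒫`
indexed by partitions (equivalently, by Young diagrams) with scalars `c_{λ↗μ}` such that
`D_α J_λ = (Σ_{□∈λ} c_α(□))·J_λ` and `p₁·J_λ = Σ_{λ↗μ} c_{λ↗μ}·J_μ`. Then for every `i ≥ 1`,
`A_i J_λ = Σ_{λ↗μ} c_α(μ∖λ)^{i−1}·(c_{λ↗μ}/α)·J_μ`.
(Here `A i` denotes the operator `A_{i+1}` of the paper, so the exponent is `i`.) -/
theorem action_of_A_on_Jack_family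
    (J : YoungDiagram → R) (hJ : ∀ lam, J lam ∈ Psub)
    (c : YoungDiagram → YoungDiagram → K)
    (hEigen : ∀ lam : YoungDiagram,
      Dalpha (J lam) = (∑ box ∈ lam.cells, contentAlpha box) • J lam)
    (hPieri : ∀ lam : YoungDiagram,
      P 1 * J lam = ∑ᶠ (mu : YoungDiagram) (_ : Covers lam mu), c lam mu • J mu) :
    ∀ (i : ℕ) (lam : YoungDiagram),
      A i (J lam) = ∑ᶠ (mu : YoungDiagram) (_ : Covers lam mu),
        ((∑ box ∈ mu.cells \ lam.cells, contentAlpha box) ^ i * (c lam mu / alpha)) • J mu := by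
  intro i lam
  rw [finsum_covers]
  induction i with
  | zero =>
    rw [A_zero (hJ lam), hPieri, finsum_covers, Finset.smul_sum]
    refine Finset.sum_congr rfl fun mu _ => ?_
    rw [smul_smul, pow_zero, one_mul, alpha, div_eq_inv_mul]
  | succ i ih =>
    rw [A_succ i (hJ lam), hEigen, A_smul, ih, Dalpha_eq, map_sum, Finset.smul_sum,
      Finset.smul_sum, ← Finset.sum_sub_distrib]
    refine Finset.sum_congr rfl fun mu hmu => ?_
    have hle : lam.cells ⊆ mu.cells := ((finite_covers lam).mem_toFinset.1 hmu).1
    rw [← Dalpha_eq, Dalpha_eq, map_smul, smul_comm, ← Dalpha_eq, hEigen,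
      ← Finset.sum_sdiff hle, smul_smul, smul_smul, ← sub_smul]
    congr 1
    ring
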